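/- Let G be a (P2+P3, gem, F1, F2)-free graph. If G contains an induced F3, then ω(G) ≥ 4 and χ(G) ≤ 5, so in particular χ(G) ≤ ω(G) + 1. -/

import Mathlib

open SimpleGraph

/-- The graph `P2 + P3` (disjoint union of a path on 2 and a path on 3 vertices). -/
def graphP2P3 : SimpleGraph (Fin 5) :=
  SimpleGraph.fromRel (fun x y => (x, y) ∈ ([(0,1),(2,3),(3,4)] : List (Fin 5 × Fin 5)))

/-- The gem: a path `P4` (0-1-2-3) plus a vertex 4 adjacent to all of it. -/
def graphGem : SimpleGraph (Fin 5) :=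
  SimpleGraph.fromRel (fun x y =>
    (x, y) ∈ ([(0,1),(1,2),(2,3),(4,0),(4,1),(4,2),(4,3)] : List (Fin 5 × Fin 5)))

/-- The path on three vertices. -/
def graphP3 : SimpleGraph (Fin 3) :=
  SimpleGraph.fromRel (fun x y => (x, y) ∈ ([(0,1),(1,2)] : List (Fin 3 × Fin 3)))

/-- The cycle on five vertices. -/
def graphC5 : SimpleGraph (Fin 5) :=
  SimpleGraph.fromRel (fun x y => y = x + 1)

/-- `F1`: a 5-cycle `v1 v2 v3 v4 v5` (vertices 0..4) plus a vertex 5 adjacent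
exactly to `v5, v1, v2` (i.e. 4, 0, 1). -/
def graphF1 : SimpleGraph (Fin 6) :=
  SimpleGraph.fromRel (fun x y =>
    (x, y) ∈ ([(0,1),(1,2),(2,3),(3,4),(4,0),(5,4),(5,0),(5,1)] : List (Fin 6 × Fin 6)))

/-- `F1'`: a 5-cycle (0..4) plus adjacent vertices 5, 6, where 5 is adjacent to 4,0,1
and 6 is adjacent to 0,1,2. -/
def graphF1' : SimpleGraph (Fin 7) :=
  SimpleGraph.fromRel (fun x y =>
    (x, y) ∈ ([(0,1),(1,2),(2,3),(3,4),(4,0),(5,4),(5,0),(5,1),(6,0),(6,1),(6,2),(5,6)] :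
      List (Fin 7 × Fin 7)))

/-- `F1''`: a 5-cycle (0..4) plus nonadjacent vertices 5, 6, where 5 is adjacent to 4,0,1
and 6 is adjacent to 1,2,3. -/
def graphF1'' : SimpleGraph (Fin 7) :=
  SimpleGraph.fromRel (fun x y =>
    (x, y) ∈ ([(0,1),(1,2),(2,3),(3,4),(4,0),(5,4),(5,0),(5,1),(6,1),(6,2),(6,3)] :
      List (Fin 7 × Fin 7)))

/-- `F2`: a 5-cycle (0..4) plus adjacent vertices 5, 6, each adjacent to `v1,v3,v4`
(i.e. 0, 2, 3). -/
def graphF2 : SimpleGraph (Fin 7) :=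
  SimpleGraph.fromRel (fun x y =>
    (x, y) ∈ ([(0,1),(1,2),(2,3),(3,4),(4,0),(5,6),(5,0),(5,2),(5,3),(6,0),(6,2),(6,3)] :
      List (Fin 7 × Fin 7)))

/-- `F3`: a 5-cycle (0..4) plus adjacent vertices 5 (adjacent to 0,2,3) and
6 (adjacent to 2,3). -/
def graphF3 : SimpleGraph (Fin 7) :=
  SimpleGraph.fromRel (fun x y =>
    (x, y) ∈ ([(0,1),(1,2),(2,3),(3,4),(4,0),(5,6),(5,0),(5,2),(5,3),(6,2),(6,3)] :
      List (Fin 7 × Fin 7)))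

/-- `G` contains no induced copy of `H`. -/
def IsFreeOf {W V : Type*} (G : SimpleGraph V) (H : SimpleGraph W) : Prop :=
  IsEmpty (H ↪g G)

/-- The disjoint union of a clique blowup `C5⟨K_{t 0},…,K_{t 4}⟩` of the 5-cycle and
`ℓ` isolated vertices. -/
def blowupC5 (t : Fin 5 → ℕ) (ℓ : ℕ) :
    SimpleGraph ((Σ i : Fin 5, Fin (t i)) ⊕ Fin ℓ) :=
  SimpleGraph.fromRel (fun x y => ∃ a b, x = Sum.inl a ∧ y = Sum.inl b ∧
    (a.1 = b.1 ∨ b.1 = a.1 + 1))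

/-- Membership in the class `𝒞`: `G` is isomorphic to the disjoint union of a clique
blowup of `C5` and some number of isolated vertices. -/
def InClassC {V : Type*} (G : SimpleGraph V) : Prop :=
  ∃ (t : Fin 5 → ℕ) (ℓ : ℕ), (∀ i, 0 < t i) ∧ Nonempty (G ≃g blowupC5 t ℓ)

/-- The function φ from the paper. -/
noncomputable def phi (x : ℕ) : ℕ :=
  if x = 1 then 1 else if x = 2 then 4 else if x = 3 then 6
  else ⌈(5 * (x : ℚ) - 1) / 4⌉₊

section Stmt
variable {V : Type*} (G : SimpleGraph V)

/-- `S` is complete to `S'`. -/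
def CompleteTo (S S' : Set V) : Prop := ∀ x ∈ S, ∀ y ∈ S', G.Adj x y

/-- `S` is anticomplete to `S'`. -/
def AnticompleteTo (S S' : Set V) : Prop := ∀ x ∈ S, ∀ y ∈ S', ¬ G.Adj x y

/-- `S` is a stable (independent) set. -/
def IsStableSet (S : Set V) : Prop := S.Pairwise (fun x y => ¬ G.Adj x y)

/-- A graph is perfect if every induced subgraph has chromatic number equal to
its clique number. -/
def IsPerfect : Prop :=
  ∀ S : Set V, (G.induce S).chromaticNumber = ((G.induce S).cliqueNum : ℕ∞)

variable (v : Fin 5 → V)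

/-- `v` induces a `C5` in `G`: two cycle vertices are adjacent iff consecutive. -/
def IsInducedC5 : Prop :=
  Function.Injective v ∧ ∀ i j : Fin 5, G.Adj (v i) (v j) ↔ (j = i + 1 ∨ i = j + 1)

def setA (i : Fin 5) : Set V :=
  {u | u ∉ Set.range v ∧ ∀ j, G.Adj u (v j) ↔ j = i}

def setB (i : Fin 5) : Set V :=
  {u | u ∉ Set.range v ∧ ∀ j, G.Adj u (v j) ↔ (j = i ∨ j = i + 1)}

def setX (i : Fin 5) : Set V :=
  {u | u ∉ Set.range v ∧ ∀ j, G.Adj u (v j) ↔ (j = i - 1 ∨ j = i + 1)}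

def setY (i : Fin 5) : Set V :=
  {u | u ∉ Set.range v ∧ ∀ j, G.Adj u (v j) ↔ (j = i - 1 ∨ j = i ∨ j = i + 1)}

def setZ (i : Fin 5) : Set V :=
  {u | u ∉ Set.range v ∧ ∀ j, G.Adj u (v j) ↔ (j = i - 2 ∨ j = i ∨ j = i + 2)}

def setT : Set V :=
  {u | u ∉ Set.range v ∧ ∀ j, ¬ G.Adj u (v j)}

end Stmt

/-- The binary relation `A` contains one of the four forbidden patterns: an induced gem,
`P2 + P3`, `F1`, or `F2`. The quantifiers are interleaved with the adjacency conditions so that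
evaluating the decision procedure prunes early. -/
def HasForbidden {W : Type*} (A : W → W → Prop) : Prop :=
  (∃ a b, A a b ∧ ∃ c, A c a ∧ A c b ∧ ∃ d, ¬ A d a ∧ A d b ∧ A d c ∧
    ∃ e, ¬ A e a ∧ A e b ∧ ¬ A e c ∧ A e d) ∨
  (∃ a b, A a b ∧ ∃ c, A c b ∧ ¬ A c a ∧ c ≠ a ∧ ∃ d, ¬ A d a ∧ ¬ A d b ∧ ¬ A d c ∧
    ∃ e, A e d ∧ ¬ A e a ∧ ¬ A e b ∧ ¬ A e c) ∨
  (∃ a b, A a b ∧ ∃ c, A c b ∧ ¬ A c a ∧ ∃ d, A d c ∧ ¬ A d b ∧ ¬ A d a ∧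
    ∃ e, A e a ∧ A e d ∧ ¬ A e b ∧ ¬ A e c ∧
    ∃ x, A x e ∧ A x a ∧ A x b ∧ ¬ A x c ∧ ¬ A x d) ∨
  (∃ a b, A a b ∧ ∃ c, A c b ∧ ¬ A c a ∧ ∃ d, A d c ∧ ¬ A d b ∧ ¬ A d a ∧
    ∃ e, A e a ∧ A e d ∧ ¬ A e b ∧ ¬ A e c ∧
    ∃ x, A x a ∧ A x c ∧ A x d ∧ ¬ A x b ∧ ¬ A x e ∧
    ∃ y, A y x ∧ A y a ∧ A y c ∧ A y d ∧ ¬ A y b ∧ ¬ A y e)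

set_option synthInstance.maxSize 1000 in
set_option synthInstance.maxHeartbeats 400000 in
instance {n : ℕ} (A : Fin n → Fin n → Prop) [DecidableRel A] :
    Decidable (HasForbidden A) := by
  unfold HasForbidden; infer_instance

theorem HasForbidden.map {W V : Type*} {A : W → W → Prop} {B : V → V → Prop} (f : W → V)
    (hf : Function.Injective f) (h : ∀ i j, A i j ↔ B (f i) (f j)) (hA : HasForbidden A) :
    HasForbidden B := by
  simp only [HasForbidden, h, ← hf.ne_iff] at hA ⊢
  rcases hA with ⟨a, b, h1, c, h2, h3, d, h4, h5, h6, e, he⟩ |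
    ⟨a, b, h1, c, h2, h3, hne, d, h4, h5, h6, e, he⟩ |
    ⟨a, b, h1, c, h2, h3, d, h4, h5, h6, e, h7, h8, h9, h10, x, hx⟩ |
    ⟨a, b, h1, c, h2, h3, d, h4, h5, h6, e, h7, h8, h9, h10, x, k1, k2, k3, k4, k5, y, hy⟩
  · exact Or.inl ⟨_, _, h1, _, h2, h3, _, h4, h5, h6, _, he⟩
  · exact Or.inr (Or.inl ⟨_, _, h1, _, h2, h3, hne, _, h4, h5, h6, _, he⟩)
  · exact Or.inr (Or.inr (Or.inl
      ⟨_, _, h1, _, h2, h3, _, h4, h5, h6, _, h7, h8, h9, h10, _, hx⟩))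
  · exact Or.inr (Or.inr (Or.inr
      ⟨_, _, h1, _, h2, h3, _, h4, h5, h6, _, h7, h8, h9, h10, _, k1, k2, k3, k4, k5, _, hy⟩))

/-- To contradict `H`-freeness it suffices to give distinct vertices of `G` whose adjacencies agree
with those of `H` on pairs `i < j`. -/
theorem IsFreeOf.elim {n : ℕ} {V : Type*} {G : SimpleGraph V} {H : SimpleGraph (Fin n)}
    (hH : IsFreeOf G H) (f : Fin n → V)
    (h : ∀ i j, i < j → f j ≠ f i ∧ (G.Adj (f j) (f i) ↔ H.Adj j i)) : False := by
  refine hH.false ⟨⟨f, fun i j hij => ?_⟩, fun {i j} => ?_⟩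
  · rcases lt_trichotomy i j with hlt | rfl | hlt
    · exact absurd hij.symm (h i j hlt).1
    · rfl
    · exact absurd hij (h j i hlt).1
  · rcases lt_trichotomy i j with hlt | rfl | hlt
    · rw [G.adj_comm, H.adj_comm]; exact (h i j hlt).2
    · simp
    · exact (h j i hlt).2

theorem not_hasForbidden {V : Type*} {G : SimpleGraph V}
    (h1 : IsFreeOf G graphP2P3) (h2 : IsFreeOf G graphGem)
    (hF1 : IsFreeOf G graphF1) (hF2 : IsFreeOf G graphF2) : ¬ HasForbidden G.Adj := by
  rintro (⟨a, b, hab, c, hca, hcb, d, hda, hdb, hdc, e, hea, heb, hec, hed⟩ |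
    ⟨a, b, hab, c, hcb, hca, hne, d, hda, hdb, hdc, e, hed, hea, heb, hec⟩ |
    ⟨a, b, hab, c, hcb, hca, d, hdc, hdb, hda, e, hea, hed, heb, hec, x, hx⟩ |
    ⟨a, b, hab, c, hcb, hca, d, hdc, hdb, hda, e, hea, hed, heb, hec,
      x, hxa, hxc, hxd, hxb, hxe, y, hy⟩)
  · refine h2.elim ![a, c, d, e, b] fun i j hij => ?_
    fin_cases i <;> fin_cases j <;> simp at hij <;> simp [graphGem] <;>
      grind [G.adj_comm, G.irrefl]
  · refine h1.elim ![d, e, a, b, c] fun i j hij => ?_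
    fin_cases i <;> fin_cases j <;> simp at hij <;> simp [graphP2P3] <;>
      grind [G.adj_comm, G.irrefl]
  · refine hF1.elim ![a, b, c, d, e, x] fun i j hij => ?_
    fin_cases i <;> fin_cases j <;> simp at hij <;> simp [graphF1] <;>
      grind [G.adj_comm, G.irrefl]
  · refine hF2.elim ![a, b, c, d, e, x, y] fun i j hij => ?_
    fin_cases i <;> fin_cases j <;> simp at hij <;> simp [graphF2] <;>
      grind [G.adj_comm, G.irrefl]

/-- The adjacency relation on `Fin n` described by bit masks: for `j < i`, the vertices `i` and `j`
are adjacent iff bit `j` of `L i` is set. -/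
def CodeAdj {n : ℕ} (L : Fin n → ℕ) (i j : Fin n) : Prop :=
  (j < i ∧ (L i).testBit j = true) ∨ (i < j ∧ (L j).testBit i = true)

instance {n : ℕ} (L : Fin n → ℕ) : DecidableRel (CodeAdj L) := fun i j =>
  decidable_of_bool (bif Nat.blt j i then (L i).testBit j else
    bif Nat.blt i j then (L j).testBit i else false) <| by
  rcases lt_trichotomy i j with h | rfl | h
  · simp [CodeAdj, cond_eq_ite, h, h.not_gt]
  · simp [CodeAdj, cond_eq_ite]
  · simp [CodeAdj, cond_eq_ite, h, h.not_gt]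

/-- The bit masks `L` describe the subgraph of `G` induced by the distinct vertices `f`. -/
structure IsCode {V : Type*} (G : SimpleGraph V) {n : ℕ} (f : Fin n → V) (L : Fin n → ℕ) :
    Prop where
  inj : Function.Injective f
  adj : ∀ i j, j < i → (G.Adj (f i) (f j) ↔ (L i).testBit j = true)

theorem IsCode.not_hasForbidden {V : Type*} {G : SimpleGraph V} {n : ℕ} {f : Fin n → V}
    {L : Fin n → ℕ} (h : IsCode G f L) (hG : ¬ HasForbidden G.Adj) :
    ¬ HasForbidden (CodeAdj L) := by
  refine fun hL => hG (hL.map f h.inj fun i j => ?_)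
  rcases lt_trichotomy i j with hlt | rfl | hlt
  · simp [CodeAdj, hlt, hlt.not_gt, G.adj_comm (f i), h.adj j i hlt]
  · simp [CodeAdj]
  · simp [CodeAdj, hlt, hlt.not_gt, h.adj i j hlt]

theorem IsCode.snoc {V : Type*} {G : SimpleGraph V} {n : ℕ} {f : Fin n → V}
    {L : Fin n → ℕ} (h : IsCode G f L) {u : V} (hu : u ∉ Set.range f) {r : ℕ}
    (hr : ∀ j : Fin n, G.Adj u (f j) ↔ r.testBit j = true) :
    IsCode G (Fin.snoc f u : Fin (n + 1) → V) (Fin.snoc L r : Fin (n + 1) → ℕ) where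
  inj := Fin.snoc_injective_iff.2 ⟨h.inj, hu⟩
  adj i j hij := by
    induction i using Fin.lastCases with
    | last =>
      induction j using Fin.lastCases with
      | last => simp at hij
      | cast j => simpa using hr j
    | cast i =>
      induction j using Fin.lastCases with
      | last => exact absurd hij (Fin.castSucc_lt_last i).not_gt
      | cast j => simpa using h.adj i j (by simpa using hij)

/-- The neighbourhoods in `F3`, as bit masks. -/
def rowF3 : Fin 7 → ℕ := ![50, 5, 106, 116, 9, 77, 44]

theorem graphF3_adj_iff (i j : Fin 7) : graphF3.Adj i j ↔ (rowF3 i).testBit j = true := by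
  revert i j
  unfold graphF3
  simp only [SimpleGraph.fromRel_adj]
  decide

/-- The possible neighbourhoods in an induced `F3` of the vertices outside of it. -/
def typesF3 : List ℕ := [0, 10, 82, 20, 52, 85, 13, 75, 77, 32, 42, 65]

/-- A colour for each neighbourhood in an induced `F3`. -/
def colorF3 (s : ℕ) : Fin 5 :=
  if s ∈ [0, 10, 82, 50, 106] then 0
  else if s ∈ [20, 52, 85, 5, 116] then 1
  else if s ∈ [13, 75, 77, 9] then 2
  else if s ∈ [32, 42, 44] then 3
  else 4

theorem hasForbidden_of_notMem_typesF3 : ∀ s < 128, s ∉ typesF3 →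
    HasForbidden (CodeAdj (Fin.snoc rowF3 s : Fin 8 → ℕ)) := by
  decide +kernel

theorem hasForbidden_of_colorF3_eq : ∀ s ∈ typesF3, ∀ t ∈ typesF3, colorF3 s = colorF3 t →
    HasForbidden (CodeAdj
      (Fin.snoc (Fin.snoc rowF3 s : Fin 8 → ℕ) (2 ^ 7 ||| t) : Fin 9 → ℕ)) := by
  decide +kernel

theorem colorF3_ne : ∀ s ∈ typesF3 ++ List.ofFn rowF3, ∀ j, s.testBit (j : Fin 7) = true →
    colorF3 s ≠ colorF3 (rowF3 j) := by
  decide +kernel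

open Classical in
/-- The neighbourhood of `u` among the vertices `f`, as a bit mask. -/
noncomputable def code {V : Type*} (G : SimpleGraph V) {n : ℕ} (f : Fin n → V) (u : V) : ℕ :=
  Nat.ofBits fun i => decide (G.Adj u (f i))

theorem testBit_code {V : Type*} (G : SimpleGraph V) {n : ℕ} (f : Fin n → V) (u : V) (j : Fin n) :
    (code G f u).testBit j = true ↔ G.Adj u (f j) := by
  simp [code, Nat.testBit_ofBits_lt]

theorem code_apply {V : Type*} {G : SimpleGraph V} (v : graphF3 ↪g G) (i : Fin 7) :
    code G v (v i) = rowF3 i := by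
  have : ∀ i, rowF3 i < 2 ^ 7 := by decide
  refine Eq.trans ?_ (Nat.mod_eq_of_lt (this i))
  rw [← Nat.ofBits_testBit]
  simp [code, graphF3_adj_iff]

theorem isCode_rowF3 {V : Type*} {G : SimpleGraph V} (v : graphF3 ↪g G) : IsCode G v rowF3 where
  inj := v.injective
  adj i j _ := v.map_adj_iff.trans (graphF3_adj_iff i j)

theorem code_mem_typesF3 {V : Type*} {G : SimpleGraph V} (hG : ¬ HasForbidden G.Adj)
    (v : graphF3 ↪g G) {u : V} (hu : u ∉ Set.range v) : code G v u ∈ typesF3 := by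
  by_contra hs
  exact ((isCode_rowF3 v).snoc hu fun j => (testBit_code G v u j).symm).not_hasForbidden hG
    (hasForbidden_of_notMem_typesF3 _ (Nat.ofBits_lt_two_pow _) hs)

theorem code_mem {V : Type*} {G : SimpleGraph V} (hG : ¬ HasForbidden G.Adj)
    (v : graphF3 ↪g G) (u : V) : code G v u ∈ typesF3 ++ List.ofFn rowF3 := by
  rw [List.mem_append]
  by_cases hu : u ∈ Set.range v
  · obtain ⟨i, rfl⟩ := hu
    exact Or.inr (List.mem_ofFn.2 ⟨i, (code_apply v i).symm⟩)
  · exact Or.inl (code_mem_typesF3 hG v hu)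

theorem colorF3_code_ne {V : Type*} {G : SimpleGraph V} (hG : ¬ HasForbidden G.Adj)
    (v : graphF3 ↪g G) {u w : V} (huw : G.Adj u w) :
    colorF3 (code G v u) ≠ colorF3 (code G v w) := by
  by_cases hw : w ∈ Set.range v
  · obtain ⟨j, rfl⟩ := hw
    rw [code_apply]
    exact colorF3_ne _ (code_mem hG v u) j ((testBit_code G v u j).2 huw)
  by_cases hu : u ∈ Set.range v
  · obtain ⟨j, rfl⟩ := hu
    rw [code_apply]
    exact (colorF3_ne _ (code_mem hG v w) j ((testBit_code G v w j).2 huw.symm)).symm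
  intro heq
  have hcode := (isCode_rowF3 v).snoc hu fun j => (testBit_code G v u j).symm
  refine (hcode.snoc (u := w) (r := 2 ^ 7 ||| code G v w) ?_ fun j => ?_).not_hasForbidden hG
    (hasForbidden_of_colorF3_eq _ (code_mem_typesF3 hG v hu) _ (code_mem_typesF3 hG v hw) heq)
  · simpa [Fin.range_snoc, huw.ne'] using hw
  · induction j using Fin.lastCases with
    | last =>
      rw [Fin.snoc_last, Fin.val_last, Nat.testBit_or, Nat.testBit_two_pow_self]
      simp [huw.symm]
    | cast j => simp [Nat.testBit_two_pow_of_ne j.isLt.ne', testBit_code]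

/-- The vertices `2, 3, 5, 6` of `F3` form a clique. -/
theorem four_le_cliqueNum {V : Type*} [Fintype V] {G : SimpleGraph V} (v : graphF3 ↪g G) :
    4 ≤ G.cliqueNum := by
  have h : G.IsNClique 4 (({2, 3, 5, 6} : Finset (Fin 7)).map v.toEmbedding) := by
    refine ⟨?_, by simp⟩
    rintro _ hx _ hy hne
    simp only [Finset.coe_map, Set.mem_image, Finset.mem_coe] at hx hy
    obtain ⟨i, hi, rfl⟩ := hx
    obtain ⟨j, hj, rfl⟩ := hy
    have key : ∀ i ∈ ({2, 3, 5, 6} : Finset (Fin 7)), ∀ j ∈ ({2, 3, 5, 6} : Finset (Fin 7)),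
        i ≠ j → (rowF3 i).testBit j = true := by decide
    exact v.map_adj_iff.2 ((graphF3_adj_iff i j).2 (key i hi j hj fun h => hne (h ▸ rfl)))
  simpa [h.card_eq] using h.isClique.card_le_cliqueNum

/-- A (P2+P3, gem, F1, F2)-free graph containing an induced `F3` has `ω(G) ≥ 4`
and `χ(G) ≤ 5`, so in particular `χ(G) ≤ ω(G) + 1`. -/
theorem chi_le_five_of_F3 {V : Type*} [Fintype V] (G : SimpleGraph V)
    (h1 : IsFreeOf G graphP2P3) (h2 : IsFreeOf G graphGem)
    (hF1 : IsFreeOf G graphF1) (hF2 : IsFreeOf G graphF2)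
    (hF : Nonempty (graphF3 ↪g G)) :
    4 ≤ G.cliqueNum ∧ G.chromaticNumber ≤ 5 ∧
      G.chromaticNumber ≤ (G.cliqueNum : ℕ∞) + 1 := by
  obtain ⟨v⟩ := hF
  have hω : 4 ≤ G.cliqueNum := four_le_cliqueNum v
  have hχ : G.chromaticNumber ≤ 5 :=
    chromaticNumber_le_iff_colorable.2
      ⟨Coloring.mk _ (colorF3_code_ne (not_hasForbidden h1 h2 hF1 hF2) v)⟩
  exact ⟨hω, hχ, hχ.trans (by exact_mod_cast Nat.succ_le_succ hω)⟩
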